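/- arXiv:2003.06854 — 2 statements merged into one kernel-verified Lean document; each statement's English description precedes it below -/
import Mathlib

section
/- Let A ⊆ ω^ω be an analytic dominating set and f : A → ω^ω a Borel-measurable function. Then there exists a closed set C ⊆ A (closed in ω^ω) such that C is dominating and the restriction f↾C is continuous. -/
open Filter

/-- Eventual domination `f ≤* g`: `f n ≤ g n` for all but finitely many `n`. -/
def EvLE (f g : ℕ → ℕ) : Prop := ∀ᶠ n in atTop, f n ≤ g n

/-- A dominating family in Baire space. -/
def Dominating (S : Set (ℕ → ℕ)) : Prop := ∀ f : ℕ → ℕ, ∃ g ∈ S, EvLE f g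

/-- Every `h` agreeing with `g` below `i` is dominated by `P x` for some `x` agreeing with `s`
below `k`. -/
def GoodPos (P : (ℕ → ℕ) → (ℕ → ℕ)) (g : ℕ → ℕ) (i : ℕ) (s : ℕ → ℕ) (k : ℕ) : Prop :=
  ∀ h : ℕ → ℕ, (∀ j < i, h j = g j) → ∃ x : ℕ → ℕ, (∀ j < k, x j = s j) ∧ ∀ n, h n ≤ P x n

lemma GoodPos.congr {P : (ℕ → ℕ) → (ℕ → ℕ)} {g g' : ℕ → ℕ} {i : ℕ} {s : ℕ → ℕ} {k : ℕ}
    (hg : ∀ j < i, g j = g' j) : GoodPos P g i s k ↔ GoodPos P g' i s k := by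
  constructor
  · intro H h hh
    exact H h (fun j hj => (hh j hj).trans (hg j hj).symm)
  · intro H h hh
    exact H h (fun j hj => (hh j hj).trans (hg j hj))

lemma GoodPos.step {P : (ℕ → ℕ) → (ℕ → ℕ)} {h : ℕ → ℕ} {i : ℕ} {s : ℕ → ℕ} {k : ℕ}
    (H : GoodPos P h i s k) :
    ∃ i', i < i' ∧ ∃ m, GoodPos P h i' (Function.update s k m) (k + 1) := by
  by_contra hcon
  push Not at hcon
  have h1 : ∀ m, ¬ GoodPos P h (max m i + 1) (Function.update s k m) (k + 1) :=
    fun m => hcon _ (by omega) m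
  unfold GoodPos at h1
  push Not at h1
  choose g hg1 hg2 using h1
  let h' : ℕ → ℕ := fun j => max (h j)
    ((Finset.range (j + 1)).sup (fun m => if max m i + 1 ≤ j then g m j else 0))
  obtain ⟨x, hx1, hx2⟩ := H h' (by
    intro j hj
    have : (Finset.range (j + 1)).sup (fun m => if max m i + 1 ≤ j then g m j else 0) = 0 := by
      rw [← Nat.bot_eq_zero, Finset.sup_eq_bot_iff]
      intro m _
      rw [if_neg (by omega)]
    simp only [h', this]
    simp)
  obtain ⟨n, hn⟩ := hg2 (x k) x (by
    intro j hj
    by_cases hjk : j = k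
    · subst hjk; simp
    · rw [Function.update_of_ne hjk]
      exact hx1 j (by omega))
  have h3 := hx2 n
  have h4 : g (x k) n ≤ h' n := by
    by_cases hc : max (x k) i + 1 ≤ n
    · refine le_trans ?_ (le_max_right _ _)
      have := Finset.le_sup (f := fun m => if max m i + 1 ≤ n then g m n else 0)
        (show x k ∈ Finset.range (n + 1) by rw [Finset.mem_range]; omega)
      simpa only [if_pos hc] using this
    · rw [hg1 (x k) n (by omega)]
      exact le_max_left _ _
  omega

/-- The set of admissible next stages. -/
def stageSet (P : (ℕ → ℕ) → (ℕ → ℕ)) (h : ℕ → ℕ) (k i : ℕ) (s : ℕ → ℕ) : Set ℕ :=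
  {i' | i < i' ∧ ∃ m, GoodPos P h i' (Function.update s k m) (k + 1)}

/-- The set of admissible next moves at a stage. -/
def moveSet (P : (ℕ → ℕ) → (ℕ → ℕ)) (h : ℕ → ℕ) (k i' : ℕ) (s : ℕ → ℕ) : Set ℕ :=
  {m | GoodPos P h i' (Function.update s k m) (k + 1)}

/-- The run of the canonical strategy against `h`. -/
noncomputable def stratRun (P : (ℕ → ℕ) → (ℕ → ℕ)) (h : ℕ → ℕ) : ℕ → ℕ × (ℕ → ℕ)
  | 0 => (0, fun _ => 0)
  | k + 1 =>
    (sInf (stageSet P h k (stratRun P h k).1 (stratRun P h k).2),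
      Function.update (stratRun P h k).2 k
        (sInf (moveSet P h k (sInf (stageSet P h k (stratRun P h k).1 (stratRun P h k).2)) (stratRun P h k).2)))

lemma strat_good {P : (ℕ → ℕ) → (ℕ → ℕ)} (hP : ∀ h : ℕ → ℕ, ∃ x, ∀ n, h n ≤ P x n)
    (h : ℕ → ℕ) (k : ℕ) : GoodPos P h (stratRun P h k).1 (stratRun P h k).2 k := by
  induction k with
  | zero =>
    intro h' _
    obtain ⟨x, hx⟩ := hP h'
    exact ⟨x, by simp, hx⟩
  | succ k ih =>
    have hne : (stageSet P h k (stratRun P h k).1 (stratRun P h k).2).Nonempty := ih.step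
    have hm := Nat.sInf_mem hne
    exact Nat.sInf_mem (s := moveSet P h k _ (stratRun P h k).2) hm.2

lemma strat_stage {P : (ℕ → ℕ) → (ℕ → ℕ)} (hP : ∀ h : ℕ → ℕ, ∃ x, ∀ n, h n ≤ P x n)
    (h : ℕ → ℕ) (k : ℕ) :
    (stratRun P h (k + 1)).1 ∈ stageSet P h k (stratRun P h k).1 (stratRun P h k).2 :=
  Nat.sInf_mem (strat_good hP h k).step

lemma strat_lt {P : (ℕ → ℕ) → (ℕ → ℕ)} (hP : ∀ h : ℕ → ℕ, ∃ x, ∀ n, h n ≤ P x n)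
    (h : ℕ → ℕ) (k : ℕ) : (stratRun P h k).1 < (stratRun P h (k + 1)).1 := (strat_stage hP h k).1

lemma le_strat {P : (ℕ → ℕ) → (ℕ → ℕ)} (hP : ∀ h : ℕ → ℕ, ∃ x, ∀ n, h n ≤ P x n)
    (h : ℕ → ℕ) (k : ℕ) : k ≤ (stratRun P h k).1 := by
  induction k with
  | zero => simp
  | succ k ih => have := strat_lt hP h k; omega

lemma strat_congr {P : (ℕ → ℕ) → (ℕ → ℕ)} (hP : ∀ h : ℕ → ℕ, ∃ x, ∀ n, h n ≤ P x n)
    (h h' : ℕ → ℕ) (k : ℕ) (hh : ∀ j < (stratRun P h k).1, h j = h' j) : stratRun P h' k = stratRun P h k := by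
  induction k with
  | zero => rfl
  | succ k ih =>
    have hlt := strat_lt hP h k
    have e := ih (fun j hj => hh j (by omega))
    have hst := strat_stage hP h k
    have key : ∀ i ≤ (stratRun P h (k + 1)).1, (i ∈ stageSet P h k (stratRun P h k).1 (stratRun P h k).2 ↔
        i ∈ stageSet P h' k (stratRun P h k).1 (stratRun P h k).2) := by
      intro i hi
      unfold stageSet
      simp only [Set.mem_ofPred_eq]
      have : ∀ m, GoodPos P h i (Function.update (stratRun P h k).2 k m) (k + 1) ↔
          GoodPos P h' i (Function.update (stratRun P h k).2 k m) (k + 1) :=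
        fun m => GoodPos.congr (fun j hj => hh j (by omega))
      simp only [this]
    have e1 : sInf (stageSet P h' k (stratRun P h k).1 (stratRun P h k).2) = (stratRun P h (k + 1)).1 := by
      have hle : sInf (stageSet P h' k (stratRun P h k).1 (stratRun P h k).2) ≤ (stratRun P h (k + 1)).1 :=
        Nat.sInf_le ((key _ le_rfl).1 hst)
      refine le_antisymm hle ?_
      have hmem := Nat.sInf_mem (s := stageSet P h' k (stratRun P h k).1 (stratRun P h k).2)
        ⟨_, (key _ le_rfl).1 hst⟩
      exact Nat.sInf_le ((key _ hle).2 hmem)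
    have e2 : moveSet P h' k (stratRun P h (k + 1)).1 (stratRun P h k).2 =
        moveSet P h k (stratRun P h (k + 1)).1 (stratRun P h k).2 := by
      ext m
      exact (GoodPos.congr hh).symm
    have e3 : stratRun P h' (k + 1) = (sInf (stageSet P h' k (stratRun P h' k).1 (stratRun P h' k).2),
      Function.update (stratRun P h' k).2 k
        (sInf (moveSet P h' k (sInf (stageSet P h' k (stratRun P h' k).1 (stratRun P h' k).2))
          (stratRun P h' k).2))) := rfl
    rw [e3, e, e1, e2]
    rfl

lemma strat_coherent (P : (ℕ → ℕ) → (ℕ → ℕ)) (h : ℕ → ℕ) (k j : ℕ) (hj : j < k) :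
    (stratRun P h k).2 j = (stratRun P h (j + 1)).2 j := by
  induction k with
  | zero => omega
  | succ k ih =>
    by_cases hjk : j = k
    · subst hjk; rfl
    · rw [← ih (by omega)]
      exact Function.update_of_ne hjk _ _

lemma exists_prefix_nhds (x : ℕ → ℕ) (U : Set (ℕ → ℕ)) (hU : U ∈ nhds x) :
    ∃ K, ∀ z : ℕ → ℕ, (∀ j < K, z j = x j) → z ∈ U := by
  rw [nhds_pi, Filter.mem_pi] at hU
  obtain ⟨I, hI, t, ht, hsub⟩ := hU
  obtain ⟨K, hK⟩ := hI.bddAbove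
  refine ⟨K + 1, fun z hz => hsub ?_⟩
  intro i hi
  rw [hz i (Nat.lt_succ_of_le (hK hi))]
  exact mem_of_mem_nhds (ht i)

lemma eventually_prefix (x : ℕ → ℕ) (K : ℕ) : ∀ᶠ z in nhds x, ∀ j < K, x j = z j := by
  have : ∀ᶠ z in nhds x, ∀ j ∈ Finset.range K, x j = z j := by
    rw [Filter.eventually_all_finset]
    intro j _
    have h1 : Tendsto (fun z : ℕ → ℕ => z j) (nhds x) (nhds (x j)) := (continuous_apply j).tendsto x
    rw [nhds_discrete ℕ] at h1
    filter_upwards [h1 (show {x j} ∈ pure (x j) by simp)] with z hz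
    exact hz.symm
  simpa using this

/-- Continuous selection of witnesses for domination. -/
lemma exists_continuous_selector (P : (ℕ → ℕ) → (ℕ → ℕ)) (hc : Continuous P)
    (hP : ∀ h : ℕ → ℕ, ∃ x, ∀ n, h n ≤ P x n) :
    ∃ τ : (ℕ → ℕ) → (ℕ → ℕ), Continuous τ ∧ ∀ h n, h n ≤ P (τ h) n := by
  refine ⟨fun h k => (stratRun P h (k + 1)).2 k, ?_, ?_⟩
  · refine continuous_pi (fun k => ?_)
    rw [continuous_iff_continuousAt]
    intro h
    refine tendsto_nhds_of_eventually_eq ?_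
    filter_upwards [eventually_prefix h (stratRun P h (k + 1)).1] with h' hh'
    rw [strat_congr hP h h' (k + 1) hh']
  · intro h n
    set x : ℕ → ℕ := fun k => (stratRun P h (k + 1)).2 k with hx
    have h1 : {z | P z n = P x n} ∈ nhds x := by
      have : Tendsto (fun z => P z n) (nhds x) (nhds (P x n)) :=
        ((continuous_apply n).comp hc).tendsto x
      rw [nhds_discrete ℕ] at this
      exact this (show {P x n} ∈ pure (P x n) by simp)
    obtain ⟨K, hK⟩ := exists_prefix_nhds x _ h1
    obtain ⟨z, hz1, hz2⟩ := strat_good hP h K h (fun _ _ => rfl)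
    have : P z n = P x n := hK z (fun j hj => by rw [hz1 j hj, strat_coherent P h K j hj])
    rw [← this]
    exact hz2 n

lemma Dominating.uniform {A : Set (ℕ → ℕ)} (hA : Dominating A) :
    ∃ m, ∀ h : ℕ → ℕ, ∃ y ∈ A, ∀ n, h n ≤ y (n + m) := by
  by_contra hcon
  push Not at hcon
  choose h hh using hcon
  obtain ⟨y, hy, hev⟩ := hA (fun i => (Finset.range (i + 1)).sup (fun m => h m (i - m)))
  obtain ⟨N, hN⟩ := eventually_atTop.1 hev
  obtain ⟨n, hn⟩ := hh N y hy
  have h1 := hN (n + N) (by omega)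
  have h2 := Finset.le_sup (f := fun m => h m (n + N - m))
    (show N ∈ Finset.range (n + N + 1) by rw [Finset.mem_range]; omega)
  simp only [Nat.add_sub_cancel] at h1 h2
  omega

lemma isProperMap_of_le (p : (ℕ → ℕ) → (ℕ → ℕ)) (hp : Continuous p) (m : ℕ)
    (hle : ∀ h n, h n ≤ p h (n + m)) : IsProperMap p := by
  rw [isProperMap_iff_ultrafilter]
  refine ⟨hp, fun 𝒰 y hy => ?_⟩
  have h1 : ∀ n, ∃ c, ∀ᶠ h in (𝒰 : Filter (ℕ → ℕ)), h n = c := by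
    intro n
    have hev : ∀ᶠ h in (𝒰 : Filter (ℕ → ℕ)), ∃ c ∈ Set.Iic (y (n + m)), h n = c := by
      have ht : Tendsto (fun h => p h (n + m)) 𝒰 (nhds (y (n + m))) :=
        ((continuous_apply (n + m)).tendsto y).comp hy
      rw [nhds_discrete ℕ] at ht
      filter_upwards [ht (show {y (n + m)} ∈ pure (y (n + m)) by simp)] with h hh
      have hh' : p h (n + m) = y (n + m) := hh
      exact ⟨h n, by rw [Set.mem_Iic, ← hh']; exact hle h n, rfl⟩
    have := (Ultrafilter.eventually_exists_mem_iff (Set.finite_Iic (y (n + m)))).1 hev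
    obtain ⟨c, _, hc⟩ := this
    exact ⟨c, hc⟩
  choose c hc using h1
  have h2 : (𝒰 : Filter (ℕ → ℕ)) ≤ nhds c := by
    rw [← tendsto_id', tendsto_pi_nhds]
    intro n
    exact tendsto_nhds_of_eventually_eq (hc n)
  exact ⟨c, tendsto_nhds_unique ((hp.tendsto c).mono_left h2) hy, h2⟩

lemma exists_refine {X : Type} [tX : TopologicalSpace X] [PolishSpace X] [MeasurableSpace X]
    [BorelSpace X] [Nonempty X] (F : X → (ℕ → ℕ)) (hF : Measurable F) :
    ∃ e : (ℕ → ℕ) → X, Continuous e ∧ Function.Surjective e ∧ Continuous (F ∘ e) := by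
  have H := hF.exists_continuous
  obtain ⟨t', H'⟩ := H
  obtain ⟨e, he, hsurj⟩ := @PolishSpace.exists_nat_nat_continuous_surjective X t' H'.2.2 _
  exact ⟨e, @continuous_le_rng (ℕ → ℕ) X e _ t' tX H'.1 he, hsurj,
    @Continuous.comp (ℕ → ℕ) X (ℕ → ℕ) _ t' _ e F H'.2.1 he⟩

lemma exists_param (A : Set (ℕ → ℕ)) (hA : MeasureTheory.AnalyticSet A) (hne : A.Nonempty)
    (f : A → (ℕ → ℕ)) (hf : Measurable f) :
    ∃ π : (ℕ → ℕ) → A, Continuous π ∧ Function.Surjective π ∧ Continuous (f ∘ π) := by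
  rw [MeasureTheory.AnalyticSet] at hA
  rcases hA with h | ⟨g, hg, hr⟩
  · exact absurd h hne.ne_empty
  subst hr
  let g' : (ℕ → ℕ) → Set.range g := Set.rangeFactorization g
  have hg' : Continuous g' := hg.subtype_mk _
  have hF : Measurable (f ∘ g') := hf.comp hg'.measurable
  obtain ⟨e, he, hsurj, hc⟩ := exists_refine _ hF
  exact ⟨g' ∘ e, hg'.comp he, Set.rangeFactorization_surjective.comp hsurj, hc⟩

/-- If `A ⊆ ω^ω` is an analytic dominating set and `f : A → ω^ω` is Borel, then there is
a closed (in `ω^ω`) dominating set `C ⊆ A` on which `f` restricts to a continuous map. -/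
theorem dominating_closed_subset_with_continuous_restriction
    (A : Set (ℕ → ℕ)) (hA : MeasureTheory.AnalyticSet A) (hdom : Dominating A)
    (f : A → (ℕ → ℕ)) (hf : Measurable f) :
    ∃ (C : Set (ℕ → ℕ)) (hCA : C ⊆ A), IsClosed C ∧ Dominating C ∧
      Continuous (f ∘ Set.inclusion hCA) := by
  have hne : A.Nonempty := by
    obtain ⟨g, hg, _⟩ := hdom (fun _ => 0)
    exact ⟨g, hg⟩
  obtain ⟨π, hπ, hsurj, hfπ⟩ := exists_param A hA hne f hf
  obtain ⟨m, hm⟩ := hdom.uniform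
  obtain ⟨τ, hτ, hle⟩ := exists_continuous_selector (fun x n => (π x : ℕ → ℕ) (n + m))
    (continuous_pi fun n => (continuous_apply (n + m)).comp (continuous_subtype_val.comp hπ))
    (by
      intro h
      obtain ⟨y, hy, hyn⟩ := hm h
      obtain ⟨x, hx⟩ := hsurj ⟨y, hy⟩
      exact ⟨x, fun n => by rw [hx]; exact hyn n⟩)
  let p : (ℕ → ℕ) → (ℕ → ℕ) := fun h => (π (τ h) : ℕ → ℕ)
  have hp : Continuous p := continuous_subtype_val.comp (hπ.comp hτ)
  have hprop : IsProperMap p := isProperMap_of_le p hp m hle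
  have hCA : Set.range p ⊆ A := by
    rintro _ ⟨h, rfl⟩
    exact (π (τ h)).2
  refine ⟨Set.range p, hCA, hprop.isClosedMap.isClosed_range, ?_, ?_⟩
  · intro h
    refine ⟨_, ⟨fun n => h (n + m), rfl⟩, ?_⟩
    refine eventually_atTop.2 ⟨m, fun n hn => ?_⟩
    have := hle (fun n => h (n + m)) (n - m)
    simpa only [Nat.sub_add_cancel hn] using this
  · let q : (ℕ → ℕ) → Set.range p := Set.rangeFactorization p
    have hq : Continuous q := hp.subtype_mk _
    have hqc : IsClosedMap q := by
      intro S hS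
      have : q '' S = Subtype.val ⁻¹' (p '' S) := by
        ext z
        constructor
        · rintro ⟨x, hx, rfl⟩
          exact ⟨x, hx, rfl⟩
        · rintro ⟨x, hx, hxz⟩
          exact ⟨x, hx, Subtype.ext hxz⟩
      rw [this]
      exact (hprop.isClosedMap S hS).preimage continuous_subtype_val
    have hquot : Topology.IsQuotientMap q :=
      hqc.isQuotientMap hq Set.rangeFactorization_surjective
    rw [hquot.continuous_iff]
    exact hfπ.comp hτ
end

section
/- Let A ⊆ ω^ω × ω^ω be an analytic set. Then the set S = {x ∈ ω^ω : the section A_x = {y ∈ ω^ω : (x,y) ∈ A} is non-dominating} is Δ¹₂: there exist coanalytic sets P, Q ⊆ ω^ω × ω^ω such that S is the projection of P onto the first coordinate and ω^ω \ S is the projection of Q onto the first coordinate. -/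
open Filter

/-- Agreement of two sequences below `n`. -/
def AgreeBelow (n : ℕ) (f g : ℕ → ℕ) : Prop := ∀ i < n, f i = g i

/-- Positions lost for the player building the witness. -/
inductive Lost (K : (ℕ → ℕ) → (ℕ → ℕ) → Prop) :
    (ℕ → ℕ) → ℕ → (ℕ → ℕ) → ℕ → Prop
  | dead (g : ℕ → ℕ) (n : ℕ) (z : ℕ → ℕ) (j : ℕ)
      (h : ∀ g' z', AgreeBelow n g' g → AgreeBelow j z' z → ¬ K g' z') : Lost K g n z j
  | step (g : ℕ → ℕ) (n : ℕ) (z : ℕ → ℕ) (j : ℕ) (h : ℕ → ℕ) (hh : AgreeBelow n h g)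
      (H : ∀ n', n < n' → ∀ z', AgreeBelow j z' z → Lost K h n' z' (j + 1)) : Lost K g n z j

theorem Lost.congr_left {K : (ℕ → ℕ) → (ℕ → ℕ) → Prop} {g g' : ℕ → ℕ} {n : ℕ}
    {z : ℕ → ℕ} {j : ℕ} (hg : AgreeBelow n g g') (h : Lost K g n z j) : Lost K g' n z j := by
  cases h with
  | dead _ _ _ _ h =>
    exact Lost.dead _ _ _ _ fun a b ha hb =>
      h a b (fun i hi => (ha i hi).trans (hg i hi).symm) hb
  | step _ _ _ _ h hh H =>
    exact Lost.step _ _ _ _ h (fun i hi => (hh i hi).trans (hg i hi)) H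

theorem AgreeBelow.symm {n : ℕ} {f g : ℕ → ℕ} (h : AgreeBelow n f g) : AgreeBelow n g f :=
  fun i hi => (h i hi).symm

theorem Lost.congr_iff {K : (ℕ → ℕ) → (ℕ → ℕ) → Prop} {g g' : ℕ → ℕ} {n : ℕ}
    {z : ℕ → ℕ} {j : ℕ} (hg : AgreeBelow n g g') : Lost K g n z j ↔ Lost K g' n z j :=
  ⟨Lost.congr_left hg, Lost.congr_left hg.symm⟩

theorem Lost.exists_bad {K : (ℕ → ℕ) → (ℕ → ℕ) → Prop}
    (hmono : ∀ f f' z, (∀ i, f' i ≤ f i) → K f z → K f' z)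
    {g : ℕ → ℕ} {n : ℕ} {z : ℕ → ℕ} {j : ℕ} (h : Lost K g n z j) :
    ∃ f, AgreeBelow n f g ∧ ∀ z', AgreeBelow j z' z → ¬ K f z' := by
  induction h with
  | dead g n z j h => exact ⟨g, fun _ _ => rfl, fun z' hz => h g z' (fun _ _ => rfl) hz⟩
  | step g n z j h hh H ih =>
    have hz : ∀ a, AgreeBelow j (Function.update z j a) z := by
      intro a i hi
      simp [Function.update, hi.ne]
    choose f hf1 hf2 using fun a => ih (max (n + 1) a) (by omega) _ (hz a)
    refine ⟨fun i => max (h i) ((Finset.range (i + 1)).sup fun a => f a i), ?_, ?_⟩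
    · intro i hi
      have : ((Finset.range (i + 1)).sup fun a => f a i) ≤ h i := by
        apply Finset.sup_le
        intro a _
        exact (hf1 a i (by omega)).le
      show max _ _ = _
      rw [max_eq_left this, hh i hi]
    · intro z' hz' hK
      refine hf2 (z' j) z' ?_ (hmono _ _ _ ?_ hK)
      · intro i hi
        rcases Nat.lt_succ_iff_lt_or_eq.1 hi with h1 | h1
        · rw [hz _ i h1, hz' i h1]
        · subst h1; simp
      · intro i
        rcases lt_or_ge i (z' j) with h1 | h1
        · rw [hf1 (z' j) i (by omega)]; exact le_max_left _ _
        · refine le_max_of_le_right ?_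
          exact Finset.le_sup (f := fun a => f a i) (Finset.mem_range.2 (by omega))

/-- Next reading depth. -/
noncomputable def nextN (K : (ℕ → ℕ) → (ℕ → ℕ) → Prop) (g : ℕ → ℕ) (n : ℕ) (z : ℕ → ℕ)
    (j : ℕ) : ℕ :=
  sInf {n' | n < n' ∧ ∃ z', AgreeBelow j z' z ∧ ¬ Lost K g n' z' (j + 1)}

/-- Next partial witness. -/
noncomputable def nextZ (K : (ℕ → ℕ) → (ℕ → ℕ) → Prop) (g : ℕ → ℕ) (n' : ℕ) (z : ℕ → ℕ)
    (j : ℕ) : ℕ → ℕ :=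
  Classical.epsilon fun z' => AgreeBelow j z' z ∧ ¬ Lost K g n' z' (j + 1)

/-- The run of the strategy against `g`. -/
noncomputable def runSt (K : (ℕ → ℕ) → (ℕ → ℕ) → Prop) (g : ℕ → ℕ) : ℕ → ℕ × (ℕ → ℕ)
  | 0 => (0, fun _ => 0)
  | j + 1 => (nextN K g (runSt K g j).1 (runSt K g j).2 j,
      nextZ K g (nextN K g (runSt K g j).1 (runSt K g j).2 j) (runSt K g j).2 j)

theorem next_spec {K : (ℕ → ℕ) → (ℕ → ℕ) → Prop} {g : ℕ → ℕ} {n : ℕ} {z : ℕ → ℕ} {j : ℕ}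
    (h : ¬ Lost K g n z j) :
    n < nextN K g n z j ∧ AgreeBelow j (nextZ K g (nextN K g n z j) z j) z ∧
      ¬ Lost K g (nextN K g n z j) (nextZ K g (nextN K g n z j) z j) (j + 1) := by
  have hne : {n' | n < n' ∧ ∃ z', AgreeBelow j z' z ∧ ¬ Lost K g n' z' (j + 1)}.Nonempty := by
    by_contra hcon
    apply h
    refine Lost.step _ _ _ _ g (fun _ _ => rfl) fun n' hn z' hz => ?_
    by_contra hl
    exact hcon ⟨n', hn, z', hz, hl⟩
  have := Nat.sInf_mem hne
  exact ⟨this.1, Classical.epsilon_spec this.2⟩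

theorem exists_local_uniformization (K : (ℕ → ℕ) → (ℕ → ℕ) → Prop)
    (hmono : ∀ f f' z, (∀ i, f' i ≤ f i) → K f z → K f' z)
    (hclosed : ∀ g z, (∀ k, ∃ g' z', AgreeBelow k g' g ∧ AgreeBelow k z' z ∧ K g' z') → K g z)
    (htot : ∀ f, ∃ z, K f z) :
    ∃ F : (ℕ → ℕ) → (ℕ → ℕ), (∀ g, K g (F g)) ∧
      ∀ g j, ∃ n, ∀ g', AgreeBelow n g' g → F g' j = F g j := by
  have hL : ∀ g j, ¬ Lost K g (runSt K g j).1 (runSt K g j).2 j := by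
    intro g j
    induction j with
    | zero =>
      intro h
      obtain ⟨f, -, hf⟩ := h.exists_bad hmono
      obtain ⟨z, hz⟩ := htot f
      exact hf z (fun i hi => absurd hi (Nat.not_lt_zero i)) hz
    | succ j ih => exact (next_spec ih).2.2
  have hn : ∀ g j, j ≤ (runSt K g j).1 := by
    intro g j
    induction j with
    | zero => exact Nat.zero_le _
    | succ j ih => exact lt_of_le_of_lt ih (next_spec (hL g j)).1
  have hz : ∀ g j, AgreeBelow j (runSt K g (j + 1)).2 (runSt K g j).2 :=
    fun g j => (next_spec (hL g j)).2.1
  have hz2 : ∀ g i j, i < j → (runSt K g j).2 i = (runSt K g (i + 1)).2 i := by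
    intro g i j hij
    induction j, hij using Nat.le_induction with
    | base => rfl
    | succ j hj ih => rw [hz g j i hj, ih]
  have hloc : ∀ g g' j, AgreeBelow (runSt K g j).1 g' g → runSt K g' j = runSt K g j := by
    intro g g' j
    induction j with
    | zero => intro _; rfl
    | succ j ih =>
      intro h
      have hlt := (next_spec (hL g j)).1
      have e := ih fun i hi => h i (lt_trans hi hlt)
      have hlt' := (next_spec (hL g' j)).1
      have hs := (next_spec (hL g j)).2
      have hs' := (next_spec (hL g' j)).2
      rw [e] at hlt' hs'
      have h' : AgreeBelow (nextN K g (runSt K g j).1 (runSt K g j).2 j) g' g := h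
      have en : nextN K g' (runSt K g j).1 (runSt K g j).2 j =
          nextN K g (runSt K g j).1 (runSt K g j).2 j := by
        apply le_antisymm
        · exact Nat.sInf_le ⟨hlt, _, hs.1, fun hl => hs.2 (hl.congr_left h')⟩
        · by_contra hcon
          push Not at hcon
          refine hcon.not_ge (Nat.sInf_le ⟨hlt', _, hs'.1, fun hl => hs'.2 (hl.congr_left ?_)⟩)
          exact fun i hi => (h' i (lt_trans hi hcon)).symm
      have ez : nextZ K g' (nextN K g (runSt K g j).1 (runSt K g j).2 j) (runSt K g j).2 j =
          nextZ K g (nextN K g (runSt K g j).1 (runSt K g j).2 j) (runSt K g j).2 j := by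
        unfold nextZ
        congr 1
        funext z'
        rw [Lost.congr_iff h']
      simp only [runSt]
      rw [e, en, ez]
  refine ⟨fun g i => (runSt K g (i + 1)).2 i, fun g => hclosed _ _ fun k => ?_, fun g j => ?_⟩
  · have := hL g k
    by_contra hcon
    apply this
    refine Lost.dead _ _ _ _ fun g' z' hg' hz' hK => hcon ⟨g', z', ?_, ?_, hK⟩
    · exact fun i hi => hg' i (lt_of_lt_of_le hi (hn g k))
    · exact fun i hi => (hz' i hi).trans (hz2 g i k hi)
  · refine ⟨(runSt K g (j + 1)).1, fun g' h => ?_⟩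
    show (runSt K g' (j + 1)).2 j = (runSt K g (j + 1)).2 j
    rw [hloc g g' (j + 1) h]

/-- Code of an output index together with an initial segment. -/
def segCode (j n : ℕ) (g : ℕ → ℕ) : ℕ :=
  Encodable.encode (j, List.ofFn fun i : Fin n => g i)

/-- Evaluation of a code of a continuous function. -/
noncomputable def evalCode (σ g : ℕ → ℕ) (j : ℕ) : ℕ := ⨆ n, σ (segCode j n g)

theorem measurable_evalCode :
    Measurable fun p : (ℕ → ℕ) × (ℕ → ℕ) => evalCode p.1 p.2 := by
  refine measurable_pi_lambda _ fun j => Measurable.iSup fun n => ?_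
  have hc : Measurable fun g : ℕ → ℕ => segCode j n g := by
    have h1 : Measurable fun g : ℕ → ℕ => fun i : Fin n => g i :=
      measurable_pi_lambda _ fun i => measurable_pi_apply _
    have h2 : Measurable fun u : Fin n → ℕ => Encodable.encode (j, List.ofFn u) :=
      measurable_of_countable _
    exact h2.comp h1
  have h3 : Measurable fun q : (ℕ → ℕ) × ℕ => q.1 q.2 :=
    measurable_from_prod_countable_left fun k => measurable_pi_apply k
  exact h3.comp (measurable_fst.prodMk (hc.comp measurable_snd))

theorem exists_code (F : (ℕ → ℕ) → (ℕ → ℕ))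
    (hF : ∀ g j, ∃ n, ∀ g', AgreeBelow n g' g → F g' j = F g j) :
    ∃ σ, ∀ g, evalCode σ g = F g := by
  classical
  let good : ℕ → ℕ → ℕ → Prop := fun c j a =>
    ∃ n g, c = segCode j n g ∧ ∀ g', AgreeBelow n g' g → F g' j = a
  have key : ∀ j n g a, good (segCode j n g) j a ↔ ∀ g', AgreeBelow n g' g → F g' j = a := by
    intro j n g a
    refine ⟨?_, fun h => ⟨n, g, rfl, h⟩⟩
    rintro ⟨n', g₁, hc, h⟩ g' hg'
    have h1 := Encodable.encode_injective hc
    have h2 := (Prod.mk.inj h1).2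
    have hl : n = n' := by simpa using congrArg List.length h2
    subst hl
    have h3 := List.ofFn_injective h2
    exact h g' fun i hi => (hg' i hi).trans (congrFun h3 ⟨i, hi⟩)
  let σ : ℕ → ℕ := fun c =>
    if h : ∃ a, good c ((Encodable.decode (α := ℕ × List ℕ) c).elim 0 Prod.fst) a
    then h.choose else 0
  have hσ : ∀ j n g, σ (segCode j n g) =
      if h : ∃ a, good (segCode j n g) j a then h.choose else 0 := by
    intro j n g
    have : ((Encodable.decode (α := ℕ × List ℕ) (segCode j n g)).elim 0 Prod.fst) = j := by
      simp [segCode]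
    simp only [σ, this]
  refine ⟨σ, fun g => funext fun j => ?_⟩
  have hle : ∀ n, σ (segCode j n g) ≤ F g j := by
    intro n
    rw [hσ]
    split_ifs with h
    · have := (key _ _ _ _).1 h.choose_spec g fun _ _ => rfl
      exact this.ge
    · exact Nat.zero_le _
  obtain ⟨n, hn⟩ := hF g j
  have heq : σ (segCode j n g) = F g j := by
    rw [hσ]
    have h : ∃ a, good (segCode j n g) j a := ⟨_, (key _ _ _ _).2 hn⟩
    rw [dif_pos h]
    exact ((key _ _ _ _).1 h.choose_spec g fun _ _ => rfl).symm
  apply le_antisymm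
  · exact ciSup_le hle
  · rw [← heq]
    exact le_ciSup (f := fun n => σ (segCode j n g))
      ⟨F g j, by rintro _ ⟨n, rfl⟩; exact hle n⟩ n

theorem measurableSet_evLE {α : Type*} [MeasurableSpace α] {u v : α → ℕ → ℕ}
    (hu : Measurable u) (hv : Measurable v) : MeasurableSet {p | EvLE (u p) (v p)} := by
  have : {p | EvLE (u p) (v p)} = ⋃ N : ℕ, ⋂ n : ℕ, {p | N ≤ n → u p n ≤ v p n} := by
    ext p
    simp [EvLE, eventually_atTop]
  rw [this]
  refine MeasurableSet.iUnion fun N => MeasurableSet.iInter fun n => ?_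
  by_cases h : N ≤ n
  · simp only [h, true_imp_iff]
    exact measurableSet_le ((measurable_pi_apply n).comp hu) ((measurable_pi_apply n).comp hv)
  · simp [h]

theorem closed_of_agree {C : Set ((ℕ → ℕ) × (ℕ → ℕ))} (hC : IsClosed C) (g z : ℕ → ℕ)
    (h : ∀ k, ∃ g' z', AgreeBelow k g' g ∧ AgreeBelow k z' z ∧ (g', z') ∈ C) : (g, z) ∈ C := by
  choose g' z' hg hz hm using h
  have tend : ∀ (a : ℕ → ℕ) (b : ℕ → ℕ → ℕ), (∀ k, AgreeBelow k (b k) a) →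
      Tendsto b atTop (nhds a) := by
    intro a b hb
    rw [tendsto_pi_nhds]
    intro i
    refine tendsto_const_nhds.congr' ?_
    filter_upwards [eventually_gt_atTop i] with k hk
    exact (hb k i hk).symm
  exact hC.mem_of_tendsto ((tend _ _ hg).prodMk_nhds (tend _ _ hz)) (Eventually.of_forall hm)

theorem dominating_iff_code (φ : (ℕ → ℕ) → (ℕ → ℕ) × (ℕ → ℕ)) (hφ : Continuous φ)
    (x : ℕ → ℕ) :
    Dominating {y | (x, y) ∈ Set.range φ} ↔
      ∃ σ, ∀ g, (φ (evalCode σ g)).1 = x ∧ EvLE g (φ (evalCode σ g)).2 := by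
  constructor
  · intro hD
    have hm : ∃ m, ∀ f : ℕ → ℕ, ∃ z, (φ z).1 = x ∧ ∀ i, m ≤ i → f i ≤ (φ z).2 i := by
      by_contra hcon
      push Not at hcon
      choose f hf using hcon
      obtain ⟨y, ⟨z, hz⟩, hy⟩ := hD fun n => (Finset.range (n + 1)).sup fun m => f m n
      obtain ⟨m, hm⟩ := eventually_atTop.1 hy
      obtain ⟨i, hi, hlt⟩ := hf m z (by rw [hz])
      have h1 := hm i hi
      have h2 : f m i ≤ (Finset.range (i + 1)).sup fun m => f m i :=
        Finset.le_sup (f := fun m => f m i) (Finset.mem_range.2 (by omega))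
      rw [hz] at hlt
      exact absurd (h2.trans h1) (not_le.2 hlt)
    obtain ⟨m, hm⟩ := hm
    have hC : IsClosed {p : (ℕ → ℕ) × (ℕ → ℕ) |
        (φ p.2).1 = x ∧ ∀ i, m ≤ i → p.1 i ≤ (φ p.2).2 i} := by
      simp only [Set.ofPred_and, Set.ofPred_forall]
      refine (isClosed_eq (by fun_prop) continuous_const).inter ?_
      refine isClosed_iInter fun i => isClosed_iInter fun _ => isClosed_le (by fun_prop) ?_
      exact (continuous_apply i).comp (continuous_snd.comp (hφ.comp continuous_snd))
    obtain ⟨F, hF, hloc⟩ := exists_local_uniformization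
      (fun g z => (φ z).1 = x ∧ ∀ i, m ≤ i → g i ≤ (φ z).2 i)
      (fun f f' z h hk => ⟨hk.1, fun i hi => (h i).trans (hk.2 i hi)⟩)
      (fun g z h => closed_of_agree hC g z h) hm
    obtain ⟨σ, hσ⟩ := exists_code F hloc
    refine ⟨σ, fun g => ?_⟩
    rw [hσ]
    exact ⟨(hF g).1, eventually_atTop.2 ⟨m, (hF g).2⟩⟩
  · rintro ⟨σ, h⟩ f
    exact ⟨_, ⟨evalCode σ f, Prod.ext (h f).1 rfl⟩, (h f).2⟩

/-- For analytic `A ⊆ ω^ω × ω^ω`, the set of `x` whose section `A_x` is non-dominating is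
`Δ¹₂`: both it and its complement are projections of coanalytic subsets of `ω^ω × ω^ω`. -/
theorem nonDominating_sections_delta12
    (A : Set ((ℕ → ℕ) × (ℕ → ℕ))) (hA : MeasureTheory.AnalyticSet A) :
    ∃ P Q : Set ((ℕ → ℕ) × (ℕ → ℕ)),
      MeasureTheory.AnalyticSet Pᶜ ∧ MeasureTheory.AnalyticSet Qᶜ ∧
      {x : ℕ → ℕ | ¬ Dominating {y : ℕ → ℕ | (x, y) ∈ A}} = Prod.fst '' P ∧
      {x : ℕ → ℕ | ¬ Dominating {y : ℕ → ℕ | (x, y) ∈ A}}ᶜ = Prod.fst '' Q := by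
  rw [MeasureTheory.AnalyticSet] at hA
  rcases hA with rfl | ⟨φ, hφ, rfl⟩
  · refine ⟨Set.univ, ∅, ?_, ?_, ?_, ?_⟩
    · simpa using MeasureTheory.analyticSet_empty
    · exact MeasurableSet.empty.compl.analyticSet
    · ext x
      simp [Dominating]
    · ext x
      simp [Dominating]
  haveI hp1 : PolishSpace (ℕ → ℕ) := inferInstance
  haveI hp2 : PolishSpace ((ℕ → ℕ) × (ℕ → ℕ)) := inferInstance
  haveI hp3 : PolishSpace (((ℕ → ℕ) × (ℕ → ℕ)) × (ℕ → ℕ)) := inferInstance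
  have hφm : Measurable φ := hφ.measurable
  have hφ1 : Measurable fun z => (φ z).1 := measurable_fst.comp hφm
  have hφ2 : Measurable fun z => (φ z).2 := measurable_snd.comp hφm
  refine ⟨{p | ∀ z, (φ z).1 = p.1 → ¬ EvLE p.2 (φ z).2},
    {p | ∀ g, (φ (evalCode p.2 g)).1 = p.1 ∧ EvLE g (φ (evalCode p.2 g)).2}, ?_, ?_, ?_, ?_⟩
  · have hB : MeasurableSet {q : ((ℕ → ℕ) × (ℕ → ℕ)) × (ℕ → ℕ) |
        (φ q.2).1 = q.1.1 ∧ EvLE q.1.2 (φ q.2).2} := by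
      refine MeasurableSet.inter (measurableSet_eq_fun (hφ1.comp measurable_snd)
        (measurable_fst.comp measurable_fst)) ?_
      exact measurableSet_evLE (measurable_snd.comp measurable_fst) (hφ2.comp measurable_snd)
    have hC := hB.analyticSet
    convert hC.image_of_continuous continuous_fst using 1
    ext p
    simp
  · have hB : MeasurableSet {q : ((ℕ → ℕ) × (ℕ → ℕ)) × (ℕ → ℕ) |
        (φ (evalCode q.1.2 q.2)).1 = q.1.1 ∧ EvLE q.2 (φ (evalCode q.1.2 q.2)).2} := by
      have hE : Measurable fun q : ((ℕ → ℕ) × (ℕ → ℕ)) × (ℕ → ℕ) => evalCode q.1.2 q.2 :=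
        measurable_evalCode.comp
          ((measurable_snd.comp measurable_fst).prodMk measurable_snd)
      refine MeasurableSet.inter (measurableSet_eq_fun (hφ1.comp hE)
        (measurable_fst.comp measurable_fst)) ?_
      exact measurableSet_evLE measurable_snd (hφ2.comp hE)
    have hC := hB.compl.analyticSet
    convert hC.image_of_continuous continuous_fst using 1
    ext p
    simp
  · ext x
    constructor
    · intro h
      simp only [Set.mem_ofPred_eq, Dominating] at h
      push Not at h
      obtain ⟨f, hf⟩ := h
      exact ⟨(x, f), fun z hz => hf _ ⟨z, Prod.ext hz rfl⟩, rfl⟩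
    · rintro ⟨⟨x, f⟩, hf, rfl⟩ hD
      obtain ⟨y, ⟨z, hz⟩, hy⟩ := hD f
      refine hf z (by rw [hz]) ?_
      rw [hz]
      exact hy
  · ext x
    rw [Set.mem_compl_iff, Set.mem_ofPred_eq, not_not, dominating_iff_code φ hφ x]
    constructor
    · rintro ⟨σ, h⟩
      exact ⟨(x, σ), h, rfl⟩
    · rintro ⟨⟨x, σ⟩, h, rfl⟩
      exact ⟨σ, h⟩
end
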